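/- For every 0 ≤ k ≤ N one has S u_k = (−1)^{N−k}·q^{(k+1)(N−k)}·u_{N−k}. -/

import Mathlib

/-- The variable `q` in the field `ℚ(q)` of rational functions. -/
noncomputable def qq : RatFunc ℚ := RatFunc.X

/-- The quantum integer `[m] = ∑_{s=0}^{m-1} q^{m-1-2s} = (q^m - q^{-m})/(q - q^{-1})`. -/
noncomputable def qint (m : ℕ) : RatFunc ℚ :=
  ∑ s ∈ Finset.range m, qq ^ ((m : ℤ) - 1 - 2 * (s : ℤ))

/-- The quantum factorial `[m]! = [m][m-1]⋯[1]`. -/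
noncomputable def qfact (m : ℕ) : RatFunc ℚ :=
  ∏ r ∈ Finset.range m, qint (r + 1)

/-- The `(N+1)`-dimensional `ℚ(q)`-vector space with basis `u_0, …, u_N`. -/
abbrev Vmod (N : ℕ) := Fin (N + 1) →₀ RatFunc ℚ

/-- The basis vector `u_k`. -/
noncomputable def uvec {N : ℕ} (k : Fin (N + 1)) : Vmod N := Finsupp.single k 1

/-- A linear operator on `Vmod N` defined by its values on the basis `u_k`. -/
noncomputable def mkOpV {N : ℕ} (f : Fin (N + 1) → Vmod N) :
    Vmod N →ₗ[RatFunc ℚ] Vmod N :=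
  Finsupp.lift (Vmod N) (RatFunc ℚ) (Fin (N + 1)) f

/-- `E u_k = [k] u_{k−1}` (and `E u_0 = 0`, the coefficient `[0]` vanishing). -/
noncomputable def EopV (N : ℕ) : Vmod N →ₗ[RatFunc ℚ] Vmod N :=
  mkOpV fun k => qint k • uvec ⟨(k : ℕ) - 1, by omega⟩

/-- `F u_k = [N−k] u_{k+1}` (and `F u_N = 0`). -/
noncomputable def FopV (N : ℕ) : Vmod N →ₗ[RatFunc ℚ] Vmod N :=
  mkOpV fun k =>
    if h : (k : ℕ) + 1 ≤ N then qint (N - (k : ℕ)) • uvec ⟨(k : ℕ) + 1, by omega⟩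
    else 0

/-- The diagonal operator multiplying `u_k` by `q^{f(N−2k)}`.  Taking `f = id`,
`f = -·` and `f = w ↦ w(w+1)/2` yields `q^H`, `q^{−H}` and `q^{H(H+1)/2}`. -/
noncomputable def qHV (N : ℕ) (f : ℤ → ℤ) : Vmod N →ₗ[RatFunc ℚ] Vmod N :=
  mkOpV fun k => (qq ^ f ((N : ℤ) - 2 * (k : ℕ))) • uvec k

/-- `exp_{q^{−1}}(x) = ∑_{n ≥ 0} q^{−n(n−1)/2} x^n/[n]!` for a nilpotent
operator `x`; the sum is finite, all terms with `n > N + 1` vanishing for the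
operators considered here (which satisfy `x^{N+1} = 0`). -/
noncomputable def qexpOpV {N : ℕ} (x : Vmod N →ₗ[RatFunc ℚ] Vmod N) :
    Vmod N →ₗ[RatFunc ℚ] Vmod N :=
  ∑ n ∈ Finset.range (N + 2),
    (qq ^ (-((n * (n - 1) / 2 : ℕ) : ℤ)) / qfact n) • x ^ n

/-- The quantum Weyl group operator
`S = exp_{q^{−1}}(q^{−1} E q^{−H}) ∘ exp_{q^{−1}}(−F) ∘ exp_{q^{−1}}(q E q^{H}) ∘ q^{H(H+1)/2}`
of `U_q(sl₂)` acting on the `(N+1)`-dimensional irreducible representation. -/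
noncomputable def SopV (N : ℕ) : Vmod N →ₗ[RatFunc ℚ] Vmod N :=
  qexpOpV (qq⁻¹ • (EopV N ∘ₗ qHV N (fun w => -w))) ∘ₗ
    qexpOpV (-(FopV N)) ∘ₗ
      qexpOpV (qq • (EopV N ∘ₗ qHV N id)) ∘ₗ
        qHV N (fun w => w * (w + 1) / 2)

theorem qq_ne_zero : qq ≠ 0 := RatFunc.X_ne_zero

theorem qq_pow_ne_one {n : ℕ} (hn : n ≠ 0) : qq ^ n ≠ 1 := by
  intro h
  have h' : (Polynomial.X ^ n : Polynomial ℚ) = 1 := by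
    apply RatFunc.algebraMap_injective (K := ℚ)
    simpa [qq] using h
  have hdeg := congrArg Polynomial.natDegree h'
  simp at hdeg
  exact hn hdeg

theorem qint_mul (m : ℕ) : qint m * (qq - qq⁻¹) = qq ^ (m : ℤ) - qq ^ (-(m : ℤ)) := by
  have h (s : ℕ) : qq ^ ((m : ℤ) - 1 - 2 * s) * (qq - qq⁻¹) =
      qq ^ ((m : ℤ) - 2 * s) - qq ^ ((m : ℤ) - 2 * (s + 1 : ℕ)) := by
    rw [mul_sub, ← zpow_add_one₀ qq_ne_zero, ← zpow_sub_one₀ qq_ne_zero]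
    push_cast
    ring_nf
  rw [qint, Finset.sum_mul, Finset.sum_congr rfl fun s _ => h s,
    Finset.sum_range_sub' (fun s : ℕ => qq ^ ((m : ℤ) - 2 * s))]
  push_cast
  ring_nf

theorem qq_sub_inv_ne_zero : qq - qq⁻¹ ≠ 0 := by
  intro h
  have h2 : qq ^ 2 = 1 := by
    have := qq_ne_zero
    rw [sub_eq_zero] at h
    field_simp at h
    exact h
  exact qq_pow_ne_one two_ne_zero h2

theorem qint_ne_zero {m : ℕ} (hm : m ≠ 0) : qint m ≠ 0 := by
  intro h
  have h1 := qint_mul m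
  rw [h, zero_mul, eq_comm, sub_eq_zero, zpow_neg, zpow_natCast] at h1
  have h0 : qq ^ m ≠ 0 := pow_ne_zero _ qq_ne_zero
  have h2 : qq ^ (m + m) = 1 := by
    rw [pow_add]
    nth_rewrite 1 [h1]
    exact inv_mul_cancel₀ h0
  exact qq_pow_ne_one (by omega) h2

theorem qint_add (a b : ℕ) : qint (a + b) = qq ^ (b : ℤ) * qint a + qq ^ (-(a : ℤ)) * qint b := by
  apply mul_right_cancel₀ qq_sub_inv_ne_zero
  rw [add_mul, mul_assoc, mul_assoc, qint_mul, qint_mul, qint_mul, mul_sub, mul_sub,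
    ← zpow_add₀ qq_ne_zero, ← zpow_add₀ qq_ne_zero, ← zpow_add₀ qq_ne_zero,
    ← zpow_add₀ qq_ne_zero]
  push_cast
  ring_nf

theorem qint_zero : qint 0 = 0 := by simp [qint]

theorem qfact_zero : qfact 0 = 1 := by simp [qfact]

theorem qfact_succ (n : ℕ) : qfact (n + 1) = qfact n * qint (n + 1) :=
  Finset.prod_range_succ _ _

theorem qfact_ne_zero (n : ℕ) : qfact n ≠ 0 :=
  Finset.prod_ne_zero_iff.2 fun r _ => qint_ne_zero r.succ_ne_zero

/-- The symmetric Gaussian binomial coefficient `[n]! / ([k]! [n-k]!)`, zero for `k > n`. -/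
noncomputable def qbinom (n k : ℕ) : RatFunc ℚ :=
  if k ≤ n then qfact n / (qfact k * qfact (n - k)) else 0

theorem qbinom_of_lt {n k : ℕ} (h : n < k) : qbinom n k = 0 := if_neg (by omega)

theorem qbinom_add (a b : ℕ) : qbinom (a + b) a = qfact (a + b) / (qfact a * qfact b) := by
  rw [qbinom, if_pos (by omega), Nat.add_sub_cancel_left]

theorem qbinom_zero_right (n : ℕ) : qbinom n 0 = 1 := by
  simp [qbinom, qfact_zero, qfact_ne_zero]

theorem qbinom_self (n : ℕ) : qbinom n n = 1 := by
  simp [qbinom, qfact_zero, qfact_ne_zero]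

theorem qbinom_sub {n k : ℕ} (h : k ≤ n) : qbinom n (n - k) = qbinom n k := by
  rw [qbinom, qbinom, if_pos h, if_pos (by omega), Nat.sub_sub_self h, mul_comm]

theorem qfact_mul_qbinom_succ (n k : ℕ) :
    qfact (k + 1) * qbinom n (k + 1) = qfact k * qbinom n k * qint (n - k) := by
  rcases lt_trichotomy n k with h | rfl | h
  · rw [qbinom_of_lt h, qbinom_of_lt (by omega)]; simp
  · rw [qbinom_of_lt (by omega)]; simp [qint_zero]
  · obtain ⟨b, rfl⟩ : ∃ b, n = k + 1 + b := ⟨n - (k + 1), by omega⟩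
    rw [qbinom_add, show k + 1 + b - k = b + 1 by omega,
      show k + 1 + b = k + (b + 1) by omega, qbinom_add, qfact_succ b]
    have := qfact_ne_zero (k + 1)
    have := qfact_ne_zero k
    have := qfact_ne_zero b
    have := qint_ne_zero b.succ_ne_zero
    field_simp

theorem qbinom_succ_succ_aux {c d : RatFunc ℚ} {n k : ℕ}
    (hd : n = k → d = 1)
    (h : k < n → qint (n + 1) = c * qint (n - k) + d * qint (k + 1)) :
    qbinom (n + 1) (k + 1) = c * qbinom n (k + 1) + d * qbinom n k := by
  rcases lt_trichotomy n k with hnk | hnk | hnk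
  · rw [qbinom_of_lt hnk, qbinom_of_lt (by omega), qbinom_of_lt (by omega)]; simp
  · rw [hd hnk, hnk, qbinom_self, qbinom_self, qbinom_of_lt (by omega)]; simp
  · have hq := h hnk
    obtain ⟨b, rfl⟩ : ∃ b, n = k + 1 + b := ⟨n - (k + 1), by omega⟩
    rw [show k + 1 + b - k = b + 1 by omega] at hq
    rw [qbinom_add, show k + 1 + b + 1 = k + 1 + (b + 1) by omega, qbinom_add,
      show k + 1 + b = k + (b + 1) by omega, qbinom_add, ← add_assoc (k + 1), qfact_succ (k + 1 + b),
      qfact_succ b, qfact_succ k, hq, show k + 1 + b = k + (b + 1) by omega]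
    have := qfact_ne_zero k
    have := qfact_ne_zero b
    have := qint_ne_zero b.succ_ne_zero
    have := qint_ne_zero k.succ_ne_zero
    field_simp

theorem qbinom_succ_succ (n k : ℕ) :
    qbinom (n + 1) (k + 1) =
      qq ^ (-((k : ℤ) + 1)) * qbinom n (k + 1) + qq ^ ((n : ℤ) - k) * qbinom n k := by
  apply qbinom_succ_succ_aux
  · rintro rfl; simp
  · intro h
    have := qint_add (k + 1) (n - k)
    rw [show k + 1 + (n - k) = n + 1 by omega, Nat.cast_sub h.le] at this
    rw [this]
    push_cast
    ring

theorem qbinom_succ_succ' (n k : ℕ) :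
    qbinom (n + 1) (k + 1) =
      qq ^ ((k : ℤ) + 1) * qbinom n (k + 1) + qq ^ ((k : ℤ) - n) * qbinom n k := by
  apply qbinom_succ_succ_aux
  · rintro rfl; simp
  · intro h
    have := qint_add (n - k) (k + 1)
    rw [show n - k + (k + 1) = n + 1 by omega, Nat.cast_sub h.le, neg_sub] at this
    rw [this]
    push_cast
    ring

theorem sum_qbinom_mul_qbinom (k m s : ℕ) (h : k ≤ m + s) :
    ∑ j ∈ Finset.range (k + 1),
        (-1) ^ j * qq ^ ((j : ℤ) * ((k : ℤ) - s - 1)) * (qbinom k j * qbinom (m + s - j) s) =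
      qq ^ ((k : ℤ) * m) * qbinom (m + s - k) m := by
  induction k generalizing m with
  | zero =>
    have := qbinom_sub (n := m + s) (k := s) (by omega)
    simp_all [qbinom_self]
  | succ k ih =>
    rcases m with _ | m
    · rw [Finset.sum_eq_single 0]
      · simp [qbinom_zero_right, qbinom_self]
      · intro j hj hj0
        rw [qbinom_of_lt (n := 0 + s - j) (by simp at hj; omega)]
        simp
      · simp
    have h1 := ih (m + 1) (by omega)
    have h2 := ih m (by omega)
    have hstep (j : ℕ) :
        (-1 : RatFunc ℚ) ^ (j + 1) * qq ^ (((j + 1 : ℕ) : ℤ) * (((k + 1 : ℕ) : ℤ) - s - 1)) *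
          (qbinom (k + 1) (j + 1) * qbinom (m + 1 + s - (j + 1)) s) =
        (-1) ^ (j + 1) * qq ^ (((j + 1 : ℕ) : ℤ) * ((k : ℤ) - s - 1)) *
          (qbinom k (j + 1) * qbinom (m + 1 + s - (j + 1)) s) -
        qq ^ (2 * (k : ℤ) - s) * ((-1) ^ j * qq ^ ((j : ℤ) * ((k : ℤ) - s - 1)) *
          (qbinom k j * qbinom (m + s - j) s)) := by
      rw [show m + 1 + s - (j + 1) = m + s - j by omega, qbinom_succ_succ]
      have e1 : qq ^ (((j + 1 : ℕ) : ℤ) * ((k : ℤ) - s - 1)) =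
          qq ^ (((j + 1 : ℕ) : ℤ) * (((k + 1 : ℕ) : ℤ) - s - 1)) * qq ^ (-((j : ℤ) + 1)) := by
        rw [← zpow_add₀ qq_ne_zero]; congr 1; push_cast; ring
      have e2 : qq ^ (2 * (k : ℤ) - s) * qq ^ ((j : ℤ) * ((k : ℤ) - s - 1)) =
          qq ^ (((j + 1 : ℕ) : ℤ) * (((k + 1 : ℕ) : ℤ) - s - 1)) * qq ^ ((k : ℤ) - j) := by
        rw [← zpow_add₀ qq_ne_zero, ← zpow_add₀ qq_ne_zero]; congr 1; push_cast; ring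
      rw [e1]
      linear_combination ((-1 : RatFunc ℚ) ^ j * qbinom k j * qbinom (m + s - j) s) * e2
    rw [Finset.sum_range_succ', Finset.sum_congr rfl fun j _ => hstep j, Finset.sum_sub_distrib,
      ← Finset.mul_sum, h2]
    have h3 := Finset.sum_range_succ' (fun j => (-1) ^ j * qq ^ ((j : ℤ) * ((k : ℤ) - s - 1)) *
      (qbinom k j * qbinom (m + 1 + s - j) s)) (k + 1)
    rw [Finset.sum_range_succ, h1, qbinom_of_lt (n := k) (k := k + 1) (by omega)] at h3
    obtain ⟨n, hn⟩ : ∃ n, m + s = n + k := ⟨m + s - k, by omega⟩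
    rw [show m + 1 + s - k = n + 1 by omega, qbinom_succ_succ'] at h3
    rw [show m + 1 + s - (k + 1) = n by omega, show m + s - k = n by omega]
    have hn' : (s : ℤ) = n + k - m := by omega
    have e1 : qq ^ ((k : ℤ) * (m + 1 : ℕ)) * qq ^ ((m : ℤ) - n) =
        qq ^ (2 * (k : ℤ) - s) * qq ^ ((k : ℤ) * m) := by
      rw [← zpow_add₀ qq_ne_zero, ← zpow_add₀ qq_ne_zero, hn']; congr 1; push_cast; ring
    have e2 : qq ^ (((k + 1 : ℕ) : ℤ) * (m + 1 : ℕ)) =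
        qq ^ ((k : ℤ) * (m + 1 : ℕ)) * qq ^ ((m : ℤ) + 1) := by
      rw [← zpow_add₀ qq_ne_zero]; congr 1; push_cast; ring
    rw [e2]
    simp only [qbinom_zero_right, Nat.cast_zero, zero_mul, pow_zero, zpow_zero] at h3 ⊢
    linear_combination -h3 + qbinom n m * e1

theorem sum_qbinom_mul_qbinom_self {M i : ℕ} (h : i ≤ M) :
    ∑ m ∈ Finset.range (M + 1),
        (-1) ^ (M - m) * qq ^ (((M : ℤ) - m) * ((M : ℤ) - i - 1)) * (qbinom M m * qbinom m i) =
      if i = M then 1 else 0 := by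
  have key := sum_qbinom_mul_qbinom M (M - i) i (by omega)
  rw [← Finset.sum_flip] at key
  rw [Nat.sub_add_cancel h, Nat.sub_self] at key
  convert key using 1
  · refine Finset.sum_congr rfl fun m hm => ?_
    have hm' : m ≤ M := by simp at hm; omega
    rw [qbinom_sub hm', Nat.sub_sub_self hm', Nat.cast_sub hm']
  · split_ifs with hi
    · simp [hi, qbinom_self]
    · rw [qbinom_of_lt (by omega), mul_zero]

/-- The basis of `Vmod N` indexed by all natural numbers, zero beyond `N`. -/
noncomputable def uext (N n : ℕ) : Vmod N :=
  if h : n < N + 1 then uvec ⟨n, h⟩ else 0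

theorem uext_coe {N : ℕ} (k : Fin (N + 1)) : uext N k = uvec k := by
  simp [uext, k.is_lt]

theorem mkOpV_uvec {N : ℕ} (f : Fin (N + 1) → Vmod N) (k : Fin (N + 1)) :
    mkOpV f (uvec k) = f k := by
  simp [mkOpV, uvec]

theorem EopV_uext {N k : ℕ} (hk : k ≤ N) : EopV N (uext N k) = qint k • uext N (k - 1) := by
  rw [uext, dif_pos (by omega), uext, dif_pos (by omega), EopV, mkOpV_uvec]

theorem FopV_uext (N k : ℕ) : FopV N (uext N k) = qint (N - k) • uext N (k + 1) := by
  by_cases hk : k < N + 1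
  · rw [uext, dif_pos hk, FopV, mkOpV_uvec]
    by_cases hk' : k + 1 ≤ N
    · rw [dif_pos hk', uext, dif_pos (by omega)]
    · rw [dif_neg hk', show N - k = 0 by omega, qint_zero, zero_smul]
  · rw [uext, dif_neg hk, map_zero, uext, dif_neg (by omega), smul_zero]

theorem qHV_uext {N k : ℕ} (hk : k ≤ N) (f : ℤ → ℤ) :
    qHV N f (uext N k) = qq ^ f ((N : ℤ) - 2 * k) • uext N k := by
  rw [uext, dif_pos (by omega), qHV, mkOpV_uvec]

theorem two_mul_triangle (n : ℕ) : 2 * ((n * (n - 1) / 2 : ℕ) : ℤ) = (n : ℤ) * (n - 1) := by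
  rw [← Finset.sum_range_id, mul_comm]
  have h := Finset.sum_range_id_mul_two n
  rcases n with _ | n
  · simp
  · rw [Nat.add_sub_cancel] at h
    rw [Nat.cast_succ, add_sub_cancel_right]
    exact_mod_cast h

theorem lowering_pow_uext {N : ℕ} {x : Vmod N →ₗ[RatFunc ℚ] Vmod N} {α β : ℤ}
    (hx : ∀ k ≤ N, x (uext N k) = (qq ^ (α + β * k) * qint k) • uext N (k - 1))
    {k : ℕ} (hk : k ≤ N) (n : ℕ) :
    (x ^ n) (uext N k) =
      (qq ^ (n * (α + β * k) - β * (n * (n - 1) / 2 : ℕ)) * (qfact n * qbinom k n)) •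
        uext N (k - n) := by
  induction n with
  | zero => simp [qfact_zero, qbinom_zero_right]
  | succ n ih =>
    rw [pow_succ', Module.End.mul_apply, ih, map_smul, hx _ (by omega), smul_smul,
      qfact_mul_qbinom_succ, Nat.sub_sub]
    by_cases hn : n ≤ k
    · congr 1
      have e : qq ^ (((n + 1 : ℕ) : ℤ) * (α + β * k) - β * ((n + 1) * (n + 1 - 1) / 2 : ℕ)) =
          qq ^ (n * (α + β * k) - β * (n * (n - 1) / 2 : ℕ)) * qq ^ (α + β * (k - n : ℕ)) := by
        rw [← zpow_add₀ qq_ne_zero, Nat.triangle_succ]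
        congr 1
        push_cast [Nat.cast_sub hn]
        ring
      rw [e]
      ring
    · rw [qbinom_of_lt (by omega)]
      simp

theorem qexpOpV_lowering {N : ℕ} {x : Vmod N →ₗ[RatFunc ℚ] Vmod N} {α β : ℤ}
    (hx : ∀ k ≤ N, x (uext N k) = (qq ^ (α + β * k) * qint k) • uext N (k - 1))
    {k : ℕ} (hk : k ≤ N) :
    qexpOpV x (uext N k) = ∑ j ∈ Finset.range (k + 1),
      (qq ^ (((k - j : ℕ) : ℤ) * (α + β * k) -
        (β + 1) * ((k - j) * (k - j - 1) / 2 : ℕ)) * qbinom k j) • uext N j := by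
  have hterm (n : ℕ) :
      ((qq ^ (-((n * (n - 1) / 2 : ℕ) : ℤ)) / qfact n) • x ^ n) (uext N k) =
      (qq ^ ((n : ℤ) * (α + β * k) - (β + 1) * (n * (n - 1) / 2 : ℕ)) * qbinom k n) •
        uext N (k - n) := by
    rw [LinearMap.smul_apply, lowering_pow_uext hx hk, smul_smul]
    congr 1
    have e : qq ^ ((n : ℤ) * (α + β * k) - (β + 1) * (n * (n - 1) / 2 : ℕ)) =
        qq ^ (-((n * (n - 1) / 2 : ℕ) : ℤ)) *
          qq ^ (n * (α + β * k) - β * (n * (n - 1) / 2 : ℕ)) := by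
      rw [← zpow_add₀ qq_ne_zero]; congr 1; ring
    have := qfact_ne_zero n
    rw [e]
    field_simp
  rw [qexpOpV, LinearMap.sum_apply, Finset.sum_congr rfl fun n _ => hterm n,
    ← Finset.sum_subset (Finset.range_subset_range.2 (by omega : k + 1 ≤ N + 2)),
    ← Finset.sum_flip]
  · refine Finset.sum_congr rfl fun j hj => ?_
    have hj' : j ≤ k := by simp at hj; omega
    rw [qbinom_sub hj', Nat.sub_sub_self hj']
  · intro n _ hn
    rw [qbinom_of_lt (by simp at hn; omega)]
    simp

theorem neg_FopV_pow_uext (N k n : ℕ) :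
    ((-(FopV N)) ^ n) (uext N k) =
      ((-1) ^ n * (qfact n * qbinom (N - k) n)) • uext N (k + n) := by
  induction n with
  | zero => simp [qfact_zero, qbinom_zero_right]
  | succ n ih =>
    rw [pow_succ', Module.End.mul_apply, ih, map_smul, LinearMap.neg_apply, FopV_uext,
      ← neg_smul, smul_smul, qfact_mul_qbinom_succ, Nat.sub_sub, add_assoc]
    congr 1
    ring

theorem qexpOpV_neg_FopV {N k : ℕ} (hk : k ≤ N) :
    qexpOpV (-(FopV N)) (uext N k) = ∑ s ∈ Finset.range (N + 1),
      ((-1) ^ (N - k - s) * qq ^ (-(((N - k - s) * (N - k - s - 1) / 2 : ℕ) : ℤ)) *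
        qbinom (N - k) s) • uext N (N - s) := by
  have hterm (n : ℕ) :
      ((qq ^ (-((n * (n - 1) / 2 : ℕ) : ℤ)) / qfact n) • (-(FopV N)) ^ n) (uext N k) =
      ((-1) ^ n * qq ^ (-((n * (n - 1) / 2 : ℕ) : ℤ)) * qbinom (N - k) n) •
        uext N (k + n) := by
    rw [LinearMap.smul_apply, neg_FopV_pow_uext, smul_smul]
    congr 1
    have := qfact_ne_zero n
    field_simp
  rw [qexpOpV, LinearMap.sum_apply, Finset.sum_congr rfl fun n _ => hterm n,
    ← Finset.sum_subset (Finset.range_subset_range.2 (by omega : N - k + 1 ≤ N + 2)),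
    ← Finset.sum_subset (Finset.range_subset_range.2 (by omega : N - k + 1 ≤ N + 1)),
    ← Finset.sum_flip]
  · refine Finset.sum_congr rfl fun s hs => ?_
    have hs' : s ≤ N - k := by simp at hs; omega
    rw [qbinom_sub hs', show k + (N - k - s) = N - s by omega]
  all_goals
    intro n _ hn
    rw [qbinom_of_lt (by simp at hn; omega)]
    simp

theorem qexpOpV_E_qH {N k : ℕ} (hk : k ≤ N) :
    qexpOpV (qq • (EopV N ∘ₗ qHV N id)) (uext N k) = ∑ j ∈ Finset.range (k + 1),
      (qq ^ (((k - j : ℕ) : ℤ) * (N + 1 + -2 * k) -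
        (-2 + 1) * ((k - j) * (k - j - 1) / 2 : ℕ)) * qbinom k j) • uext N j := by
  refine qexpOpV_lowering (fun k hk => ?_) hk
  rw [LinearMap.smul_apply, LinearMap.comp_apply, qHV_uext hk, map_smul, EopV_uext hk, smul_smul,
    smul_smul, ← zpow_one_add₀ qq_ne_zero, id]
  ring_nf

theorem qexpOpV_E_qH_neg {N k : ℕ} (hk : k ≤ N) :
    qexpOpV (qq⁻¹ • (EopV N ∘ₗ qHV N (fun w => -w))) (uext N k) =
      ∑ j ∈ Finset.range (k + 1),
        (qq ^ (((k - j : ℕ) : ℤ) * (-1 - N + 2 * k) -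
          (2 + 1) * ((k - j) * (k - j - 1) / 2 : ℕ)) * qbinom k j) • uext N j := by
  refine qexpOpV_lowering (fun k hk => ?_) hk
  rw [LinearMap.smul_apply, LinearMap.comp_apply, qHV_uext hk, map_smul, EopV_uext hk, smul_smul,
    smul_smul, ← zpow_neg_one, ← zpow_add₀ qq_ne_zero]
  ring_nf

/-- The two inner exponentials send `u_k` to a multiple of the image of `u_{N-k}` under the
inverse of the outer one. -/
theorem qexpOpV_neg_FopV_comp {N k : ℕ} (hk : k ≤ N) :
    qexpOpV (-(FopV N)) (qexpOpV (qq • (EopV N ∘ₗ qHV N id))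
        (qHV N (fun w => w * (w + 1) / 2) (uext N k))) =
      ∑ m ∈ Finset.range (N - k + 1),
        ((-1) ^ m * qq ^ (((k : ℤ) + 1) * (N - k) + (N - k - m) * (N - 2 * k - 1) -
          ((N - k - m) * (N - k - m - 1) / 2 : ℕ)) * qbinom (N - k) m) • uext N m := by
  have hcoef (m : ℕ) (hm : m ≤ N) :
      ∑ j ∈ Finset.range (k + 1),
        qq ^ (((N : ℤ) - 2 * k) * (N - 2 * k + 1) / 2) *
        ((qq ^ (((k - j : ℕ) : ℤ) * (N + 1 + -2 * k) -
          (-2 + 1) * ((k - j) * (k - j - 1) / 2 : ℕ)) * qbinom k j) *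
        ((-1) ^ (m - j) * qq ^ (-(((m - j) * (m - j - 1) / 2 : ℕ) : ℤ)) *
          qbinom (N - j) (N - m))) =
      (-1) ^ m * qq ^ (((k : ℤ) + 1) * (N - k) + (N - k - m) * (N - 2 * k - 1) -
          ((N - k - m) * (N - k - m - 1) / 2 : ℕ)) * qbinom (N - k) m := by
    obtain ⟨s, rfl⟩ := Nat.exists_eq_add_of_le hm
    have hw := Int.mul_ediv_cancel' (even_iff_two_dvd.1
      (Int.even_mul_succ_self (((m + s : ℕ) : ℤ) - 2 * k)))
    generalize hW : (((m + s : ℕ) : ℤ) - 2 * k) * (((m + s : ℕ) : ℤ) - 2 * k + 1) / 2 = W at hw ⊢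
    have hterm (j : ℕ) (hj : j ∈ Finset.range (k + 1)) :
        qq ^ W *
        ((qq ^ (((k - j : ℕ) : ℤ) * ((m + s : ℕ) + 1 + -2 * k) -
          (-2 + 1) * ((k - j) * (k - j - 1) / 2 : ℕ)) * qbinom k j) *
        ((-1) ^ (m - j) * qq ^ (-(((m - j) * (m - j - 1) / 2 : ℕ) : ℤ)) *
          qbinom (m + s - j) (m + s - m))) =
        (-1) ^ m * qq ^ (W + k * ((m + s : ℕ) + 1 - 2 * k) + (k * (k - 1) / 2 : ℕ) -
          (m * (m - 1) / 2 : ℕ)) *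
        ((-1) ^ j * qq ^ ((j : ℤ) * ((k : ℤ) - s - 1)) * (qbinom k j * qbinom (m + s - j) s)) := by
      rw [Nat.add_sub_cancel_left]
      by_cases hjm : j ≤ m
      · have hjk : j ≤ k := by simp at hj; omega
        obtain ⟨p, rfl⟩ := Nat.exists_eq_add_of_le hjm
        obtain ⟨r, rfl⟩ := Nat.exists_eq_add_of_le hjk
        rw [Nat.add_sub_cancel_left, Nat.add_sub_cancel_left]
        have h1 := two_mul_triangle r
        have h2 := two_mul_triangle p
        have h3 := two_mul_triangle (j + r)
        have h4 := two_mul_triangle (j + p)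
        generalize ((r * (r - 1) / 2 : ℕ) : ℤ) = t1 at *
        generalize ((p * (p - 1) / 2 : ℕ) : ℤ) = t2 at *
        generalize (((j + r) * (j + r - 1) / 2 : ℕ) : ℤ) = t3 at *
        generalize (((j + p) * (j + p - 1) / 2 : ℕ) : ℤ) = t4 at *
        have e : qq ^ W * qq ^ ((r : ℤ) * ((j + p + s : ℕ) + 1 + -2 * (j + r : ℕ)) -
              (-2 + 1) * t1) * qq ^ (-t2) =
            qq ^ (W + (j + r : ℕ) * ((j + p + s : ℕ) + 1 - 2 * (j + r : ℕ)) + t3 - t4) *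
              qq ^ ((j : ℤ) * ((j + r : ℕ) - s - 1)) := by
          rw [← zpow_add₀ qq_ne_zero, ← zpow_add₀ qq_ne_zero, ← zpow_add₀ qq_ne_zero]
          congr 1
          apply mul_left_cancel₀ (two_ne_zero (α := ℤ))
          push_cast at *
          linear_combination h1 - h2 - h3 + h4
        have e' : (-1 : RatFunc ℚ) ^ (j + p) * (-1) ^ j = (-1) ^ p := by
          rw [pow_add, mul_right_comm, ← mul_pow]; simp
        rw [← e']
        linear_combination ((-1 : RatFunc ℚ) ^ (j + p) * (-1) ^ j * qbinom (j + r) j *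
          qbinom (j + p + s - j) s) * e
      · rw [qbinom_of_lt (n := m + s - j) (by simp at hj; omega)]
        simp
    rw [Finset.sum_congr rfl hterm, ← Finset.mul_sum, sum_qbinom_mul_qbinom _ _ _ hk]
    by_cases hmk : m + s - k < m
    · rw [qbinom_of_lt hmk]; simp
    · obtain ⟨n, rfl⟩ := Nat.exists_eq_add_of_le (show k ≤ s by omega)
      rw [show m + (k + n) - k - m = n by omega]
      have h1 := two_mul_triangle k
      have h2 := two_mul_triangle m
      have h3 := two_mul_triangle n
      rw [← mul_assoc, mul_assoc ((-1) ^ m), ← zpow_add₀ qq_ne_zero]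
      congr 3
      apply mul_left_cancel₀ (two_ne_zero (α := ℤ))
      generalize ((k * (k - 1) / 2 : ℕ) : ℤ) = t1 at *
      generalize ((m * (m - 1) / 2 : ℕ) : ℤ) = t2 at *
      generalize ((n * (n - 1) / 2 : ℕ) : ℤ) = t3 at *
      push_cast at *
      linear_combination hw + h1 - h2 + h3
  rw [qHV_uext hk, map_smul, qexpOpV_E_qH hk, map_smul, map_sum, Finset.smul_sum]
  have hF (j : ℕ) (hj : j ∈ Finset.range (k + 1)) :=
    qexpOpV_neg_FopV (N := N) (k := j) (by simp at hj; omega)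
  simp only [map_smul]
  rw [Finset.sum_congr rfl fun j hj => by rw [hF j hj, Finset.smul_sum, Finset.smul_sum],
    Finset.sum_comm, ← Finset.sum_flip,
    Finset.sum_subset (Finset.range_subset_range.2 (by omega : N - k + 1 ≤ N + 1))]
  · refine Finset.sum_congr rfl fun m hm => ?_
    have hm' : m ≤ N := by simp at hm; omega
    rw [← hcoef m hm', Finset.sum_smul]
    refine Finset.sum_congr rfl fun j _ => ?_
    rw [smul_smul, smul_smul, Nat.sub_sub_self hm', show N - j - (N - m) = m - j by omega,
      mul_assoc]
  · intro m _ hm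
    rw [qbinom_of_lt (by simp at hm; omega)]
    simp

theorem SopV_uext {N k : ℕ} (hk : k ≤ N) :
    SopV N (uext N k) =
      ((-1) ^ (N - k) * qq ^ ((k + 1) * (N - k))) • uext N (N - k) := by
  obtain ⟨M, rfl⟩ := Nat.exists_eq_add_of_le hk
  rw [SopV, LinearMap.comp_apply, LinearMap.comp_apply, LinearMap.comp_apply,
    qexpOpV_neg_FopV_comp hk, map_sum, Nat.add_sub_cancel_left]
  have hE (m : ℕ) (hm : m ∈ Finset.range (M + 1)) :
      qexpOpV (qq⁻¹ • (EopV (k + M) ∘ₗ qHV (k + M) (fun w => -w))) (uext (k + M) m) =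
        ∑ i ∈ Finset.range (M + 1),
          (qq ^ (((m - i : ℕ) : ℤ) * (-1 - (k + M : ℕ) + 2 * m) -
            (2 + 1) * ((m - i) * (m - i - 1) / 2 : ℕ)) * qbinom m i) • uext (k + M) i := by
    have hm' : m ≤ M := by simp at hm; omega
    rw [qexpOpV_E_qH_neg (by omega),
      Finset.sum_subset (Finset.range_subset_range.2 (by omega : m + 1 ≤ M + 1))]
    intro i _ hi
    rw [qbinom_of_lt (by simp at hi; omega)]
    simp
  have hcoef (i : ℕ) (hi : i ∈ Finset.range (M + 1)) :
      ∑ m ∈ Finset.range (M + 1),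
        ((-1) ^ m * qq ^ (((k : ℤ) + 1) * ((k + M : ℕ) - k) +
          ((k + M : ℕ) - k - m) * ((k + M : ℕ) - 2 * k - 1) -
          ((M - m) * (M - m - 1) / 2 : ℕ)) * qbinom M m) *
        (qq ^ (((m - i : ℕ) : ℤ) * (-1 - (k + M : ℕ) + 2 * m) -
          (2 + 1) * ((m - i) * (m - i - 1) / 2 : ℕ)) * qbinom m i) =
      if i = M then (-1) ^ M * qq ^ ((k + 1) * M) else 0 := by
    have hi' : i ≤ M := by simp at hi; omega
    have hterm (m : ℕ) (hm : m ∈ Finset.range (M + 1)) :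
        ((-1) ^ m * qq ^ (((k : ℤ) + 1) * ((k + M : ℕ) - k) +
          ((k + M : ℕ) - k - m) * ((k + M : ℕ) - 2 * k - 1) -
          ((M - m) * (M - m - 1) / 2 : ℕ)) * qbinom M m) *
        (qq ^ (((m - i : ℕ) : ℤ) * (-1 - (k + M : ℕ) + 2 * m) -
          (2 + 1) * ((m - i) * (m - i - 1) / 2 : ℕ)) * qbinom m i) =
        (-1) ^ M * qq ^ (((k : ℤ) + 1) * M + (M - i) * (M - k - 1) -
          3 * ((M - i) * (M - i - 1) / 2 : ℕ)) *
        ((-1) ^ (M - m) * qq ^ (((M : ℤ) - m) * ((M : ℤ) - i - 1)) *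
          (qbinom M m * qbinom m i)) := by
      by_cases him : i ≤ m
      · have hm' : m ≤ M := by simp at hm; omega
        obtain ⟨p, rfl⟩ := Nat.exists_eq_add_of_le him
        obtain ⟨r, rfl⟩ := Nat.exists_eq_add_of_le hm'
        rw [Nat.add_sub_cancel_left, Nat.add_sub_cancel_left,
          show i + p + r - i = p + r by omega]
        have h1 := two_mul_triangle r
        have h2 := two_mul_triangle p
        have h3 := two_mul_triangle (p + r)
        generalize ((r * (r - 1) / 2 : ℕ) : ℤ) = t1 at *
        generalize ((p * (p - 1) / 2 : ℕ) : ℤ) = t2 at *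
        generalize (((p + r) * (p + r - 1) / 2 : ℕ) : ℤ) = t3 at *
        have e' : (-1 : RatFunc ℚ) ^ (i + p + r) * (-1) ^ r = (-1) ^ (i + p) := by
          rw [pow_add _ (i + p), mul_assoc, ← mul_pow]; simp
        have e : qq ^ (((k : ℤ) + 1) * ((k + (i + p + r) : ℕ) - k) +
              ((k + (i + p + r) : ℕ) - k - (i + p : ℕ)) * ((k + (i + p + r) : ℕ) - 2 * k - 1) -
              t1) * qq ^ ((p : ℤ) * (-1 - (k + (i + p + r) : ℕ) + 2 * (i + p : ℕ)) -
              (2 + 1) * t2) =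
            qq ^ (((k : ℤ) + 1) * (i + p + r : ℕ) +
              ((i + p + r : ℕ) - i) * ((i + p + r : ℕ) - k - 1) - 3 * t3) *
              qq ^ ((((i + p + r : ℕ) : ℤ) - (i + p : ℕ)) * (((i + p + r : ℕ) : ℤ) - i - 1)) := by
          rw [← zpow_add₀ qq_ne_zero, ← zpow_add₀ qq_ne_zero]
          congr 1
          apply mul_left_cancel₀ (two_ne_zero (α := ℤ))
          push_cast at *
          linear_combination 3 * h3 - h1 - 3 * h2
        rw [← e']
        linear_combination ((-1 : RatFunc ℚ) ^ (i + p + r) * (-1) ^ r *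
          qbinom (i + p + r) (i + p) * qbinom (i + p) i) * e
      · rw [qbinom_of_lt (n := m) (by omega)]
        simp
    rw [Finset.sum_congr rfl hterm, ← Finset.mul_sum, sum_qbinom_mul_qbinom_self hi']
    split_ifs with h
    · rw [h, ← zpow_natCast qq]
      simp
    · rw [mul_zero]
  simp only [map_smul]
  rw [Finset.sum_congr rfl fun m hm => by rw [hE m hm, Finset.smul_sum], Finset.sum_comm]
  simp only [smul_smul, ← Finset.sum_smul]
  rw [Finset.sum_congr rfl fun i hi => by rw [hcoef i hi]]
  simp

/-- `S u_k = (−1)^{N−k} q^{(k+1)(N−k)} u_{N−k}`. -/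
theorem SopV_apply_u (N : ℕ) (k : Fin (N + 1)) :
    SopV N (uvec k) =
      ((-1) ^ (N - (k : ℕ)) * qq ^ (((k : ℕ) + 1) * (N - (k : ℕ)))) •
        uvec k.rev := by
  rw [← uext_coe, ← uext_coe, Fin.val_rev, Nat.add_sub_add_right]
  exact SopV_uext (by omega)
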